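/- For all m, n, m', n' ∈ ℕ, the complex Hermite polynomials satisfy ∫_ℂ J_{m,n}(z) · conj(J_{m',n'}(z)) dγ(z) = 1 if (m,n) = (m',n') and = 0 otherwise; that is, the family {J_{m,n} : m,n ∈ ℕ} is orthonormal in L²(γ). -/

import Mathlib

open MeasureTheory Complex Filter Finset
open scoped Real ComplexConjugate

noncomputable def gamma : MeasureTheory.Measure ℂ :=
  MeasureTheory.volume.withDensity fun z =>
    ENNReal.ofReal ((2 * Real.pi)⁻¹ * Real.exp (-(z.re ^ 2 + z.im ^ 2) / 2))
/-- The complex Hermite polynomial `J_{m,n}`. -/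
noncomputable def J (m n : ℕ) (z : ℂ) : ℂ :=
  (Real.sqrt (m.factorial * n.factorial * 2 ^ (m + n)) : ℂ)⁻¹ *
    ∑ r ∈ Finset.range (min m n + 1),
      (-1 : ℂ) ^ r * (r.factorial : ℂ) * 2 ^ r * (m.choose r : ℂ) * (n.choose r : ℂ) *
        z ^ (m - r) * (conj z) ^ (n - r)


theorem altsum (m : ℕ) : ∀ p q : ℕ, p ≤ m →
    ∑ r ∈ range (m+1), (-1:ℤ)^r * (m.choose r : ℤ) * (((m + q - r).choose p : ℕ) : ℤ)
      = if p = m then 1 else 0 := by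
  intro p q hp
  have h := fwdDiff_iter_eq_sum_shift (1:ℕ) (fun x : ℕ => ((x.choose p : ℕ) : ℤ)) m q
  rw [← Finset.sum_range_reflect] at h
  have h2 : (fwdDiff (1:ℕ))^[m] (fun x : ℕ => ((x.choose p : ℕ) : ℤ)) q
      = if p = m then 1 else 0 := by
    have h0 := fwdDiff_iter_choose 0 p
    simp only [add_zero, Nat.choose_zero_right, Nat.cast_one] at h0
    split_ifs with hpm
    · subst hpm
      rw [h0]
    · obtain ⟨d, rfl⟩ : ∃ d, m = d + 1 + p := ⟨m - p - 1, by omega⟩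
      rw [Function.iterate_add_apply, h0, fwdDiff_iter_eq_sum_shift]
      have h3 := Int.alternating_sum_range_choose_of_ne (n := d + 1) (by omega)
      rw [← Finset.sum_range_reflect] at h3
      rw [← h3]
      refine sum_congr rfl fun r hr => ?_
      have hr' : r ≤ d + 1 := by simpa [Nat.lt_succ_iff] using hr
      simp [Nat.choose_symm hr']
  rw [← h2, h]
  refine sum_congr rfl fun r hr => ?_
  have hr' : r ≤ m := by simpa [Nat.lt_succ_iff] using hr
  have e2 : m - (m - r) = r := by omega
  have e3 : q + (m - r) = m + q - r := by omega
  simp [e2, e3, Nat.choose_symm hr']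

theorem gauss_int (k : ℕ) :
    ∫ x : ℂ, ‖x‖ ^ k * Real.exp (-(x.re ^ 2 + x.im ^ 2) / 2)
      = Real.pi * (1 / 2 : ℝ) ^ (-((k : ℝ) + 2) / 2) * Real.Gamma (((k : ℝ) + 2) / 2) := by
  have h := Complex.integral_rpow_mul_exp_neg_mul_rpow (p := 2) (q := k) (b := 1 / 2)
    (by norm_num) (by have : (0:ℝ) ≤ k := by positivity
                      linarith) (by norm_num)
  rw [show 2 * Real.pi / 2 = Real.pi by ring] at h
  rw [← h]
  refine integral_congr_ae (ae_of_all _ fun x => ?_)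
  simp only [Real.rpow_natCast, Real.rpow_two]
  congr 2
  rw [Complex.sq_norm, Complex.normSq_apply]
  ring

theorem gauss_integrable (k : ℕ) :
    Integrable (fun x : ℂ => ‖x‖ ^ k * Real.exp (-(x.re ^ 2 + x.im ^ 2) / 2)) := by
  by_contra hcon
  have h := gauss_int k
  rw [integral_undef hcon] at h
  have : 0 < Real.Gamma (((k : ℝ) + 2) / 2) := Real.Gamma_pos_of_pos (by positivity)
  have : 0 < Real.pi * (1 / 2 : ℝ) ^ (-((k : ℝ) + 2) / 2) * Real.Gamma (((k : ℝ) + 2) / 2) := by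
    positivity
  linarith

theorem dens_meas : Measurable fun z : ℂ =>
    ENNReal.ofReal ((2 * Real.pi)⁻¹ * Real.exp (-(z.re ^ 2 + z.im ^ 2) / 2)) := by
  fun_prop

theorem integral_gamma (f : ℂ → ℂ) : ∫ z, f z ∂gamma =
    ∫ z, (((2 * Real.pi)⁻¹ * Real.exp (-(z.re ^ 2 + z.im ^ 2) / 2) : ℝ) : ℂ) * f z := by
  rw [gamma, integral_withDensity_eq_integral_toReal_smul dens_meas
    (ae_of_all _ fun _ => ENNReal.ofReal_lt_top)]
  refine integral_congr_ae (ae_of_all _ fun x => ?_)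
  simp only
  rw [ENNReal.toReal_ofReal (by positivity), Complex.real_smul]

theorem mono_integrable (a b : ℕ) : Integrable (fun z : ℂ => z ^ a * conj z ^ b) gamma := by
  rw [gamma, integrable_withDensity_iff_integrable_smul' dens_meas
    (ae_of_all _ fun _ => ENNReal.ofReal_lt_top)]
  refine ((gauss_integrable (a + b)).const_mul (2 * Real.pi)⁻¹).mono' ?_ (ae_of_all _ fun x => ?_)
  · exact (Measurable.aestronglyMeasurable (by
      have := dens_meas.ennreal_toReal
      have h2 : Measurable fun z : ℂ => z ^ a * conj z ^ b :=
        Continuous.measurable (by fun_prop)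
      exact this.smul h2))
  · rw [ENNReal.toReal_ofReal (by positivity), norm_smul,
      Real.norm_of_nonneg (by positivity), norm_mul, norm_pow, norm_pow,
      RCLike.norm_conj, pow_add]
    apply le_of_eq
    ring

theorem moment_ne (a k : ℕ) (hk : k ≠ 0) : ∫ z, z ^ (a + k) * conj z ^ a ∂gamma = 0 := by
  rw [integral_gamma]
  set f : ℂ → ℂ := fun z =>
    (((2 * Real.pi)⁻¹ * Real.exp (-(z.re ^ 2 + z.im ^ 2) / 2) : ℝ) : ℂ) *
      (z ^ (a + k) * conj z ^ a) with hf
  set c : Circle := Circle.exp (Real.pi / k) with hc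
  have hck : (c : ℂ) ^ k = -1 := by
    rw [hc, Circle.coe_exp, ← Complex.exp_nat_mul]
    have : (k : ℂ) ≠ 0 := by exact_mod_cast hk
    rw [show (k : ℂ) * (((Real.pi / k : ℝ) : ℂ) * I) = Real.pi * I by push_cast; field_simp]
    exact Complex.exp_pi_mul_I
  have hcc : (c : ℂ) * conj (c : ℂ) = 1 := by
    rw [Complex.mul_conj, Circle.normSq_coe]; simp
  have h := (LinearIsometryEquiv.measurePreserving (rotation c)).integral_comp
    (rotation c).toHomeomorph.measurableEmbedding f
  have h2 : ∀ z, f (rotation c z) = - f z := by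
    intro z
    have hn : (c * z).re ^ 2 + (c * z).im ^ 2 = z.re ^ 2 + z.im ^ 2 := by
      have := Complex.normSq_mul c z
      rw [Circle.normSq_coe, one_mul, Complex.normSq_apply, Complex.normSq_apply] at this
      linarith
    simp only [hf, rotation_apply]
    rw [hn, map_mul, mul_pow, mul_pow, pow_add (c : ℂ), hck,
      show (c : ℂ) ^ a * -1 * z ^ (a + k) * (conj (c : ℂ) ^ a * conj z ^ a)
        = - (((c : ℂ) * conj (c : ℂ)) ^ a * (z ^ (a + k) * conj z ^ a)) by rw [mul_pow]; ring, hcc]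
    ring
  simp only [h2] at h
  rw [integral_neg] at h
  exact self_eq_neg.mp h.symm

theorem moment (a b : ℕ) :
    ∫ z, z ^ a * conj z ^ b ∂gamma = if a = b then 2 ^ a * (a.factorial : ℂ) else 0 := by
  split_ifs with h
  · subst h
    rw [integral_gamma]
    have h1 : ∀ z : ℂ, (((2 * Real.pi)⁻¹ * Real.exp (-(z.re ^ 2 + z.im ^ 2) / 2) : ℝ) : ℂ) *
        (z ^ a * conj z ^ a) = (((2 * Real.pi)⁻¹ * (‖z‖ ^ (2 * a) *
          Real.exp (-(z.re ^ 2 + z.im ^ 2) / 2)) : ℝ) : ℂ) := by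
      intro z
      rw [← mul_pow, Complex.mul_conj, pow_mul, Complex.sq_norm]
      push_cast
      ring
    simp only [h1]
    rw [integral_complex_ofReal, integral_const_mul, gauss_int]
    have e1 : (((2 * a : ℕ) : ℝ) + 2) / 2 = (a : ℝ) + 1 := by push_cast; ring
    rw [neg_div, e1, Real.Gamma_nat_eq_factorial, Real.rpow_neg (by norm_num),
      show (a : ℝ) + 1 = ((a + 1 : ℕ) : ℝ) by push_cast; rfl, Real.rpow_natCast]
    have : (2 * Real.pi)⁻¹ * (Real.pi * ((1 / 2 : ℝ) ^ (a + 1))⁻¹ * (a.factorial : ℝ))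
        = 2 ^ a * a.factorial := by
      have := Real.pi_ne_zero
      rw [one_div, inv_pow, inv_inv, pow_succ]
      field_simp
    rw [this]
    push_cast
    rfl
  · rcases lt_or_gt_of_ne h with h | h
    · obtain ⟨k, rfl⟩ := Nat.exists_eq_add_of_lt h
      have h1 := moment_ne a (k + 1) (by omega)
      rw [← map_eq_zero (starRingEnd ℂ), ← integral_conj] at h1
      rw [← h1]
      refine integral_congr_ae (ae_of_all _ fun x => ?_)
      simp [mul_comm, add_assoc]
    · obtain ⟨k, rfl⟩ := Nat.exists_eq_add_of_lt h
      exact moment_ne b (k + 1) (by omega)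

noncomputable def cf (m n r : ℕ) : ℂ :=
  (-1 : ℂ) ^ r * (r.factorial : ℂ) * 2 ^ r * (m.choose r : ℂ) * (n.choose r : ℂ)

noncomputable def HH (m n : ℕ) (z : ℂ) : ℂ :=
  ∑ r ∈ Finset.range (min m n + 1), cf m n r * (z ^ (m - r) * conj z ^ (n - r))

theorem HH_term (m n p q : ℕ) (z : ℂ) : HH m n z * (z ^ q * conj z ^ p) =
    ∑ r ∈ Finset.range (min m n + 1),
      cf m n r * (z ^ (m - r + q) * conj z ^ (n - r + p)) := by
  rw [HH, sum_mul]
  refine sum_congr rfl fun r _ => ?_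
  rw [pow_add, pow_add]
  ring

theorem HH_mono_integrable (m n p q : ℕ) :
    Integrable (fun z => HH m n z * (z ^ q * conj z ^ p)) gamma := by
  simp only [HH_term]
  exact integrable_finsetSum _ fun r _ => (mono_integrable _ _).const_mul _

theorem HH_pair (m n p q : ℕ) (hp : p ≤ m) :
    ∫ z, HH m n z * (z ^ q * conj z ^ p) ∂gamma =
      if p = m ∧ q = n then (m.factorial : ℂ) * n.factorial * 2 ^ (m + n) else 0 := by
  simp only [HH_term]
  rw [integral_finsetSum _ fun r _ => (mono_integrable _ _).const_mul _]
  simp only [integral_const_mul, moment]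
  by_cases hN : m + q = n + p
  · have hterm : ∀ r ∈ Finset.range (min m n + 1),
        cf m n r * (if m - r + q = n - r + p then
          2 ^ (m - r + q) * ((m - r + q).factorial : ℂ) else 0) =
        (2 ^ (m + q) * (n.factorial : ℂ) * p.factorial) *
          ((-1) ^ r * (m.choose r : ℂ) * ((m + q - r).choose p : ℂ)) := by
      intro r hr
      have hr' : r ≤ m ∧ r ≤ n := by
        have := Finset.mem_range.mp hr
        omega
      rw [if_pos (by omega)]
      have f1 : (n.choose r : ℂ) * r.factorial * (n - r).factorial = n.factorial := by
        exact_mod_cast Nat.choose_mul_factorial_mul_factorial hr'.2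
      have f2 : ((m + q - r).choose p : ℂ) * p.factorial * (n - r).factorial
          = (m + q - r).factorial := by
        have := Nat.choose_mul_factorial_mul_factorial (n := m + q - r) (k := p) (by omega)
        rw [show m + q - r - p = n - r by omega] at this
        exact_mod_cast this
      rw [show m - r + q = m + q - r by omega, ← f1, ← f2, cf]
      have e : (2 : ℂ) ^ (m + q) = 2 ^ r * 2 ^ (m + q - r) := by
        rw [← pow_add]; congr 1; omega
      rw [e]
      ring
    rw [sum_congr rfl hterm, ← mul_sum]
    have hext : ∑ r ∈ Finset.range (min m n + 1),
          ((-1) ^ r * (m.choose r : ℂ) * ((m + q - r).choose p : ℂ)) =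
        ∑ r ∈ Finset.range (m + 1),
          ((-1) ^ r * (m.choose r : ℂ) * ((m + q - r).choose p : ℂ)) := by
      refine sum_subset (fun r hr => ?_) (fun r hr hr2 => ?_)
      · simp only [Finset.mem_range] at *; omega
      · simp only [Finset.mem_range] at *
        rw [Nat.choose_eq_zero_of_lt (n := m + q - r) (k := p) (by omega)]
        simp
    have halt := congrArg (fun x : ℤ => (x : ℂ)) (altsum m p q hp)
    push_cast at halt
    rw [hext, halt]
    by_cases hpm : p = m
    · subst hpm
      have : q = n := by omega
      subst this
      simp
      ring
    · simp [hpm]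
  · rw [if_neg (by omega)]
    refine sum_eq_zero fun r hr => ?_
    have := Finset.mem_range.mp hr
    rw [if_neg (by omega), mul_zero]

theorem conj_two : conj (2 : ℂ) = 2 := Complex.conj_ofNat 2

theorem cf_conj (m n r : ℕ) : conj (cf m n r) = cf m n r := by
  simp [cf, conj_two]

theorem HH_orth_le (m n m' n' : ℕ) (h : m' ≤ m) :
    ∫ z, HH m n z * conj (HH m' n' z) ∂gamma =
      if m = m' ∧ n = n' then (m.factorial : ℂ) * n.factorial * 2 ^ (m + n) else 0 := by
  have h1 : ∀ z, HH m n z * conj (HH m' n' z) = ∑ s ∈ Finset.range (min m' n' + 1),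
      cf m' n' s * (HH m n z * (z ^ (n' - s) * conj z ^ (m' - s))) := by
    intro z
    conv_lhs => rw [HH.eq_def m' n', map_sum, mul_sum]
    refine sum_congr rfl fun s _ => ?_
    simp only [map_mul, map_pow, cf_conj, Complex.conj_conj]
    ring
  simp only [h1]
  rw [integral_finsetSum _ fun r _ => (HH_mono_integrable _ _ _ _).const_mul _]
  simp only [integral_const_mul]
  rw [sum_eq_single 0]
  · rw [HH_pair _ _ _ _ (by omega)]
    simp [cf, eq_comm]
  · intro s hs hs0
    have := Finset.mem_range.mp hs
    rw [HH_pair _ _ _ _ (by omega), if_neg (by omega), mul_zero]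
  · simp

theorem HH_orth (m n m' n' : ℕ) :
    ∫ z, HH m n z * conj (HH m' n' z) ∂gamma =
      if m = m' ∧ n = n' then (m.factorial : ℂ) * n.factorial * 2 ^ (m + n) else 0 := by
  rcases le_total m' m with h | h
  · exact HH_orth_le m n m' n' h
  · have h1 := congrArg conj (HH_orth_le m' n' m n h)
    rw [← integral_conj] at h1
    simp only [map_mul, Complex.conj_conj] at h1
    simp only [mul_comm (HH m n _)]
    rw [h1]
    by_cases hh : m = m' ∧ n = n'
    · obtain ⟨rfl, rfl⟩ := hh
      simp [conj_two]
    · rw [if_neg hh, if_neg (by omega), map_zero]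

theorem J_eq (m n : ℕ) (z : ℂ) : J m n z =
    (Real.sqrt (m.factorial * n.factorial * 2 ^ (m + n)) : ℂ)⁻¹ * HH m n z := by
  rw [J, HH]
  congr 1
  refine sum_congr rfl fun r _ => ?_
  rw [cf]
  ring

/-- The complex Hermite polynomials are orthonormal in `L²(γ)`. -/
theorem J_orthonormal (m n m' n' : ℕ) :
    ∫ z, J m n z * conj (J m' n' z) ∂gamma
      = if (m, n) = (m', n') then 1 else 0 := by
  have h1 : ∀ z, J m n z * conj (J m' n' z) =
      ((Real.sqrt (m.factorial * n.factorial * 2 ^ (m + n)) : ℂ)⁻¹ *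
        (Real.sqrt (m'.factorial * n'.factorial * 2 ^ (m' + n')) : ℂ)⁻¹) *
        (HH m n z * conj (HH m' n' z)) := by
    intro z
    rw [J_eq, J_eq, map_mul, map_inv₀, Complex.conj_ofReal]
    ring
  simp only [h1]
  rw [integral_const_mul, HH_orth]
  by_cases hh : m = m' ∧ n = n'
  · obtain ⟨rfl, rfl⟩ := hh
    have hpos : (0 : ℝ) < m.factorial * n.factorial * 2 ^ (m + n) := by positivity
    simp only [and_self, if_true]
    rw [← mul_inv, ← Complex.ofReal_mul, Real.mul_self_sqrt hpos.le,
      show (m.factorial : ℂ) * n.factorial * 2 ^ (m + n)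
        = ((m.factorial * n.factorial * 2 ^ (m + n) : ℝ) : ℂ) by push_cast; rfl]
    exact inv_mul_cancel₀ (by exact_mod_cast hpos.ne')
  · rw [if_neg hh, if_neg (by simpa using hh), mul_zero]
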